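/- Let A be an indecomposable algebra (the only central idempotents of A are 0 and 1) and let χ be a functorially finite subcategory of A-mod closed under extensions and containing all projective modules. Let Γ be a connected component of the Auslander–Reiten quiver of χ such that the lengths l(X) of all modules X in Γ are bounded. Then Γ is the only connected component: every indecomposable module of χ is isomorphic to a module in Γ. -/

import Mathlib

open CategoryTheory Limits

universe u

section Base
variable {A : Type} [Ring A]

/-- An object of `ModuleCat A` is indecomposable. -/
def Indec (X : ModuleCat.{0} A) : Prop :=
  Nontrivial X ∧ ∀ e : X ⟶ X, e ≫ e = e → e = 0 ∨ e = 𝟙 X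

/-- `f` is irreducible with respect to the subcategory `χ`. -/
def IrredIn (χ : ModuleCat.{0} A → Prop) {X Y : ModuleCat.{0} A} (f : X ⟶ Y) : Prop :=
  ¬ IsSplitMono f ∧ ¬ IsSplitEpi f ∧
    ∀ (Z : ModuleCat.{0} A), χ Z → ∀ (h : X ⟶ Z) (g : Z ⟶ Y), f = h ≫ g →
      IsSplitMono h ∨ IsSplitEpi g

def RightAlmostSplitIn (χ : ModuleCat.{0} A → Prop) {X Y : ModuleCat.{0} A} (f : X ⟶ Y) : Prop :=
  ¬ IsSplitEpi f ∧ ∀ (Z : ModuleCat.{0} A), χ Z → ∀ g : Z ⟶ Y, ¬ IsSplitEpi g →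
    ∃ h : Z ⟶ X, h ≫ f = g

def LeftAlmostSplitIn (χ : ModuleCat.{0} A → Prop) {X Y : ModuleCat.{0} A} (f : X ⟶ Y) : Prop :=
  ¬ IsSplitMono f ∧ ∀ (Z : ModuleCat.{0} A), χ Z → ∀ g : X ⟶ Z, ¬ IsSplitMono g →
    ∃ h : Y ⟶ Z, f ≫ h = g

def RightMinimal {X Y : ModuleCat.{0} A} (f : X ⟶ Y) : Prop :=
  ∀ h : X ⟶ X, h ≫ f = f → IsIso h

def LeftMinimal {X Y : ModuleCat.{0} A} (f : X ⟶ Y) : Prop :=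
  ∀ h : Y ⟶ Y, f ≫ h = f → IsIso h

def MinimalRightAlmostSplitIn (χ : ModuleCat.{0} A → Prop) {X Y : ModuleCat.{0} A}
    (f : X ⟶ Y) : Prop :=
  RightMinimal f ∧ RightAlmostSplitIn χ f

def MinimalLeftAlmostSplitIn (χ : ModuleCat.{0} A → Prop) {X Y : ModuleCat.{0} A}
    (f : X ⟶ Y) : Prop :=
  LeftMinimal f ∧ LeftAlmostSplitIn χ f

/-- `0 → X → Y → Z → 0` is a short exact sequence. -/
def IsSES {X Y Z : ModuleCat.{0} A} (f : X ⟶ Y) (g : Y ⟶ Z) : Prop :=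
  Function.Injective f ∧ Function.Surjective g ∧ Function.Exact f g

/-- `0 → X → Y → Z → 0` is an almost split sequence in `χ`. -/
def IsAlmostSplitSeq (χ : ModuleCat.{0} A → Prop) {X Y Z : ModuleCat.{0} A}
    (f : X ⟶ Y) (g : Y ⟶ Z) : Prop :=
  IsSES f g ∧ MinimalLeftAlmostSplitIn χ f ∧ MinimalRightAlmostSplitIn χ g

/-- `f : X → Y` is a right `χ`-approximation of `Y`. -/
def RightApprox (χ : ModuleCat.{0} A → Prop) {X Y : ModuleCat.{0} A} (f : X ⟶ Y) : Prop :=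
  χ X ∧ ∀ (Z : ModuleCat.{0} A), χ Z → ∀ g : Z ⟶ Y, ∃ h : Z ⟶ X, h ≫ f = g

def LeftApprox (χ : ModuleCat.{0} A → Prop) {X Y : ModuleCat.{0} A} (f : X ⟶ Y) : Prop :=
  χ Y ∧ ∀ (Z : ModuleCat.{0} A), χ Z → ∀ g : X ⟶ Z, ∃ h : Y ⟶ Z, f ≫ h = g

def MinimalRightApprox (χ : ModuleCat.{0} A → Prop) {X Y : ModuleCat.{0} A} (f : X ⟶ Y) : Prop :=
  RightApprox χ f ∧ RightMinimal f

def ContravariantlyFinite (χ : ModuleCat.{0} A → Prop) : Prop :=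
  ∀ Y : ModuleCat.{0} A, Module.Finite A Y → ∃ (X : ModuleCat.{0} A) (f : X ⟶ Y), RightApprox χ f

def CovariantlyFinite (χ : ModuleCat.{0} A → Prop) : Prop :=
  ∀ X : ModuleCat.{0} A, Module.Finite A X → ∃ (Y : ModuleCat.{0} A) (f : X ⟶ Y), LeftApprox χ f

def FunctoriallyFinite (χ : ModuleCat.{0} A → Prop) : Prop :=
  ContravariantlyFinite χ ∧ CovariantlyFinite χ

/-- `χ` is a subcategory of `A`-mod: its objects are finitely generated, and it is
closed under isomorphisms, finite direct sums and direct summands. -/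
def IsSubcat (χ : ModuleCat.{0} A → Prop) : Prop :=
  (∀ X : ModuleCat.{0} A, χ X → Module.Finite A X) ∧
  (∀ X Y : ModuleCat.{0} A, (X ≅ Y) → χ X → χ Y) ∧
  (∀ X Y : ModuleCat.{0} A, χ X → χ Y → χ (X ⊞ Y)) ∧
  (∀ X Y Z : ModuleCat.{0} A, (X ≅ Y ⊞ Z) → χ X → χ Y)

def ClosedUnderExtensions (χ : ModuleCat.{0} A → Prop) : Prop :=
  ∀ (X Y Z : ModuleCat.{0} A) (f : X ⟶ Y) (g : Y ⟶ Z), IsSES f g → χ X → χ Z → χ Y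

def ContainsProjectives (χ : ModuleCat.{0} A → Prop) : Prop :=
  ∀ P : ModuleCat.{0} A, Module.Finite A P → Projective P → χ P

/-- `Ω` is a resolving subcategory: closed under extensions, contains `A`, and is closed
under kernels of epimorphisms. -/
def Resolving (Ω : ModuleCat.{0} A → Prop) : Prop :=
  ClosedUnderExtensions Ω ∧ Ω (ModuleCat.of A A) ∧
  (∀ (X Y K : ModuleCat.{0} A) (f : X ⟶ Y) (i : K ⟶ X), Ω X → Ω Y →
    Function.Surjective f → Function.Injective i → Function.Exact i f → Ω K)

/-- `n` is the Jordan–Hölder length of the module `X`. -/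
def IsJHLength (X : ModuleCat.{0} A) (n : ℕ) : Prop :=
  ∃ s : CompositionSeries (Submodule A X), s.head = ⊥ ∧ s.last = ⊤ ∧ s.length = n

end Base

section Walks
variable {A : Type} [Ring A]

/-- One step of a walk in the Auslander–Reiten quiver of `χ`: `U` and `V` are
indecomposable modules of `χ` joined by an irreducible morphism in some direction
(or isomorphic). -/
def ARStep (χ : ModuleCat.{0} A → Prop) (U V : ModuleCat.{0} A) : Prop :=
  χ U ∧ χ V ∧ Indec U ∧ Indec V ∧
    ((∃ f : U ⟶ V, IrredIn χ f) ∨ (∃ f : V ⟶ U, IrredIn χ f) ∨ Nonempty (U ≅ V))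

/-- `U` and `V` are joined by a finite walk in the Auslander–Reiten quiver of `χ`. -/
def ARConnected (χ : ModuleCat.{0} A → Prop) (U V : ModuleCat.{0} A) : Prop :=
  Relation.ReflTransGen (ARStep χ) U V

end Walks

section TraceDuality

variable {K : Type} [Field K]

lemma linearMap_sum_comp {ι : Type} [Fintype ι] {X Y Z : Type} [AddCommGroup X] [Module K X]
    [AddCommGroup Y] [Module K Y] [AddCommGroup Z] [Module K Z] (f : ι → (Y →ₗ[K] Z))
    (g : X →ₗ[K] Y) : (∑ i, f i) ∘ₗ g = ∑ i, f i ∘ₗ g := by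
  ext
  simp

lemma eq_zero_of_forall_trace_comp_eq_zero {X Y : Type} [AddCommGroup X] [Module K X]
    [FiniteDimensional K X] [AddCommGroup Y] [Module K Y] [FiniteDimensional K Y] {η : Y →ₗ[K] X}
    (h : ∀ g : X →ₗ[K] Y, LinearMap.trace K X (η ∘ₗ g) = 0) : η = 0 := by
  ext y
  refine (Module.forall_dual_apply_eq_zero_iff K _).mp fun f => ?_
  have hc : η ∘ₗ f.smulRight y = f.smulRight (η y) := by ext; simp
  simpa [hc, LinearMap.trace_smulRight] using h (f.smulRight y)

lemma exists_trace_comp_eq {X Y : Type} [AddCommGroup X] [Module K X] [FiniteDimensional K X]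
    [AddCommGroup Y] [Module K Y] [FiniteDimensional K Y] (l : (X →ₗ[K] Y) →ₗ[K] K) :
    ∃ η : Y →ₗ[K] X, ∀ g : X →ₗ[K] Y, l g = LinearMap.trace K X (η ∘ₗ g) := by
  let T : (Y →ₗ[K] X) →ₗ[K] Module.Dual K (X →ₗ[K] Y) :=
    LinearMap.mk₂ K (fun η g => LinearMap.trace K X (η ∘ₗ g))
      (fun _ _ _ => by rw [LinearMap.add_comp, map_add])
      (fun _ _ _ => by rw [LinearMap.smul_comp, map_smul])
      (fun _ _ _ => by rw [LinearMap.comp_add, map_add])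
      (fun _ _ _ => by rw [LinearMap.comp_smul, map_smul])
  have hT : Function.Injective T := by
    rw [injective_iff_map_eq_zero]
    exact fun η hη => eq_zero_of_forall_trace_comp_eq_zero (LinearMap.congr_fun hη)
  have hfin : Module.finrank K (Y →ₗ[K] X) = Module.finrank K (Module.Dual K (X →ₗ[K] Y)) := by
    rw [Subspace.dual_finrank_eq, Module.finrank_linearMap, Module.finrank_linearMap, mul_comm]
  obtain ⟨η, hη⟩ := (LinearMap.injective_iff_surjective_of_finrank_eq_finrank hfin).mp hT l
  exact ⟨η, fun g => by rw [← hη]; rfl⟩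

variable {A : Type} [Ring A] [Algebra K A]

/-- The `K`-linear endomorphism given by the action of `a`. -/
abbrev actionMap (K : Type) [Field K] {A : Type} [Ring A] [Algebra K A] (X : Type)
    [AddCommGroup X] [Module K X] [Module A X] [IsScalarTower K A X] (a : A) : X →ₗ[K] X :=
  Algebra.lsmul K K X a

/-- A `K`-linear map `η` is orthogonal, for the trace pairing, to the `A`-linear maps exactly when
it is a sum of commutators with elements of a basis of `A`. -/
lemma trace_comp_eq_zero_iff_sum_commutator {ι : Type} [Fintype ι] (a : Module.Basis ι K A)
    {X Y : Type}
    [AddCommGroup X] [Module K X] [Module A X] [IsScalarTower K A X] [FiniteDimensional K X]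
    [AddCommGroup Y] [Module K Y] [Module A Y] [IsScalarTower K A Y] [FiniteDimensional K Y]
    (ζ : Y →ₗ[K] X) :
    (∀ g : X →ₗ[A] Y, LinearMap.trace K X (ζ ∘ₗ g.restrictScalars K) = 0) ↔
      ∃ η : ι → (Y →ₗ[K] X),
        ζ = ∑ i, (η i ∘ₗ actionMap K Y (a i) - actionMap K X (a i) ∘ₗ η i) := by
  constructor
  · intro h
    let d : (X →ₗ[K] Y) →ₗ[K] (ι → (X →ₗ[K] Y)) := LinearMap.pi fun i =>
      (actionMap K Y (a i)).compRight K - LinearMap.lcomp K Y (actionMap K X (a i))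
    have hd : ∀ g i, d g i = actionMap K Y (a i) ∘ₗ g - g ∘ₗ actionMap K X (a i) :=
      fun g i => rfl
    let l : (X →ₗ[K] Y) →ₗ[K] K := LinearMap.trace K X ∘ₗ ζ.compRight K
    have hl : l ∈ (LinearMap.ker d).dualAnnihilator := by
      rw [Submodule.mem_dualAnnihilator]
      intro g hg
      have hg' : ∀ (b : A) (x : X), g (b • x) = b • g x := by
        intro (b : A) (x : X)
        have key : g ∘ₗ (LinearMap.toSpanSingleton A X x).restrictScalars K =
            (LinearMap.toSpanSingleton A Y (g x)).restrictScalars K := by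
          refine a.ext fun i => ?_
          have h1 := congrFun hg i
          rw [hd] at h1
          have h2 := LinearMap.congr_fun h1 x
          simpa [sub_eq_zero, eq_comm (a := g _)] using h2
        simpa using LinearMap.congr_fun key b
      exact h { g with map_smul' := hg' }
    rw [← LinearMap.range_dualMap_eq_dualAnnihilator_ker] at hl
    obtain ⟨m, hm⟩ := hl
    classical
    choose η hη using fun i =>
      exists_trace_comp_eq (m ∘ₗ LinearMap.single K (fun _ : ι => X →ₗ[K] Y) i)
    refine ⟨η, sub_eq_zero.mp (eq_zero_of_forall_trace_comp_eq_zero fun g => ?_)⟩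
    have h1 : LinearMap.trace K X (ζ ∘ₗ g) = ∑ i, LinearMap.trace K X (η i ∘ₗ d g i) := by
      calc LinearMap.trace K X (ζ ∘ₗ g) = l g := rfl
        _ = m (d g) := by rw [← hm]; rfl
        _ = m (∑ i, Pi.single i (d g i)) := by rw [Finset.univ_sum_single]
        _ = ∑ i, LinearMap.trace K X (η i ∘ₗ d g i) := by
          rw [map_sum]
          exact Finset.sum_congr rfl fun i _ => hη i _
    rw [LinearMap.sub_comp, map_sub, h1, sub_eq_zero, linearMap_sum_comp, map_sum]
    refine Finset.sum_congr rfl fun i _ => ?_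
    rw [hd, LinearMap.comp_sub, LinearMap.sub_comp, map_sub, map_sub]
    exact congrArg (_ - ·) (LinearMap.trace_comp_comm' (actionMap K X (a i)) (η i ∘ₗ g))
  · rintro ⟨η, rfl⟩ g
    rw [linearMap_sum_comp, map_sum]
    refine Finset.sum_eq_zero fun i _ => ?_
    have hg : g.restrictScalars K ∘ₗ actionMap K X (a i) =
        actionMap K Y (a i) ∘ₗ g.restrictScalars K := by
      ext; simp
    rw [LinearMap.sub_comp, map_sub, LinearMap.comp_assoc, ← hg, sub_eq_zero]
    exact LinearMap.trace_comp_comm' (actionMap K X (a i)) (η i ∘ₗ g.restrictScalars K)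

end TraceDuality

section AlmostFactoring

variable {K : Type} [Field K] {A : Type} [Ring A] [Algebra K A]

/-- The coinduced module of `K`-linear maps from `A` to `X`. -/
def Coinduced (K A X : Type) [Field K] [Ring A] [Algebra K A] [AddCommGroup X] [Module K X] :
    Type :=
  A →ₗ[K] X

namespace Coinduced

variable {X : Type} [AddCommGroup X] [Module K X]

instance : AddCommGroup (Coinduced K A X) := inferInstanceAs (AddCommGroup (A →ₗ[K] X))

instance : Module K (Coinduced K A X) := inferInstanceAs (Module K (A →ₗ[K] X))

instance [FiniteDimensional K A] [FiniteDimensional K X] :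
    FiniteDimensional K (Coinduced K A X) :=
  inferInstanceAs (FiniteDimensional K (A →ₗ[K] X))

instance : FunLike (Coinduced K A X) A X := inferInstanceAs (FunLike (A →ₗ[K] X) A X)

instance : LinearMapClass (Coinduced K A X) K A X :=
  inferInstanceAs (LinearMapClass (A →ₗ[K] X) K A X)

@[ext] lemma ext {f g : Coinduced K A X} (h : ∀ c, f c = g c) : f = g := LinearMap.ext h

@[simp] lemma add_apply (f g : Coinduced K A X) (c : A) : (f + g) c = f c + g c := rfl

@[simp] lemma zero_apply (c : A) : (0 : Coinduced K A X) c = 0 := rfl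

@[simp] lemma smul_apply' (k : K) (f : Coinduced K A X) (c : A) : (k • f) c = k • f c := rfl

instance : SMul A (Coinduced K A X) :=
  ⟨fun b f => LinearMap.comp (show A →ₗ[K] X from f) (LinearMap.mulRight K b)⟩

@[simp] lemma smul_apply (b : A) (f : Coinduced K A X) (c : A) : (b • f) c = f (c * b) := rfl

instance : Module A (Coinduced K A X) where
  one_smul f := by ext; simp
  mul_smul a b f := by ext; simp [mul_assoc]
  smul_zero a := by ext; simp
  smul_add a f g := by ext; simp
  add_smul a b f := by ext; simp [mul_add]
  zero_smul f := by ext; simp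

instance : IsScalarTower K A (Coinduced K A X) :=
  ⟨fun k b f => by ext; simp⟩

end Coinduced

/-- A linear form on the endomorphism ring is a trace form. -/
lemma exists_trace_form {X : Type} [AddCommGroup X] [Module K X] [Module A X] [IsScalarTower K A X]
    [FiniteDimensional K X] (α : Module.End A X →ₗ[K] K) :
    ∃ θ : X →ₗ[K] X, ∀ u : Module.End A X,
      α u = LinearMap.trace K X (θ ∘ₗ u.restrictScalars K) := by
  let j : Module.End A X →ₗ[K] (X →ₗ[K] X) :=
    { toFun := fun u => u.restrictScalars K
      map_add' := fun _ _ => rfl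
      map_smul' := fun _ _ => rfl }
  have hj : LinearMap.ker j = ⊥ := by
    rw [LinearMap.ker_eq_bot]
    intro u v h
    ext x
    exact LinearMap.congr_fun h x
  obtain ⟨l, hl⟩ := LinearMap.exists_leftInverse_of_injective j hj
  obtain ⟨θ, hθ⟩ := exists_trace_comp_eq (α ∘ₗ l)
  refine ⟨θ, fun u => ?_⟩
  change _ = LinearMap.trace K X (θ ∘ₗ j u)
  rw [← hθ]
  exact congrArg α (LinearMap.congr_fun hl u).symm

variable [FiniteDimensional K A]

theorem exists_factor_right {X : Type} [AddCommGroup X] [Module K X] [Module A X]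
    [IsScalarTower K A X] [FiniteDimensional K X] (α : Module.End A X →ₗ[K] K) :
    ∃ (E : Type) (_ : AddCommGroup E) (_ : Module A E) (p : E →ₗ[A] X), Module.Finite A E ∧
      ∀ (Y : Type) [AddCommGroup Y] [Module K Y] [Module A Y] [IsScalarTower K A Y]
        [FiniteDimensional K Y] (φ : Y →ₗ[A] X),
        (∀ g : X →ₗ[A] Y, α (φ ∘ₗ g) = 0) ↔ ∃ h : Y →ₗ[A] E, p ∘ₗ h = φ := by
  obtain ⟨θ, hθ⟩ := exists_trace_form α
  let a := Module.finBasis K A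
  let E : Submodule A (X × (Fin (Module.finrank K A) → Coinduced K A X)) :=
    { carrier := {z | ∀ c : A, θ (c • z.1) = ∑ i, (z.2 i (a i * c) - a i • z.2 i c)}
      add_mem' := by
        intro z w hz hw c
        simp only [Set.mem_ofPred_eq] at hz hw
        simp only [Prod.fst_add, Prod.snd_add, smul_add, map_add, hz, hw,
          ← Finset.sum_add_distrib, Pi.add_apply, Coinduced.add_apply]
        exact Finset.sum_congr rfl fun i _ => by abel
      zero_mem' := by intro c; simp
      smul_mem' := by
        intro b z hz c
        simp only [Set.mem_ofPred_eq] at hz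
        simp [← mul_smul, hz, mul_assoc] }
  have hE : ∀ z : E, ∀ c : A, θ (c • z.1.1) = ∑ i, (z.1.2 i (a i * c) - a i • z.1.2 i c) :=
    fun z => z.2
  have : IsNoetherianRing A := isNoetherian_of_isNoetherianRing_of_finite K A |> fun _ =>
    isNoetherian_of_tower K inferInstance
  have : Module.Finite A (Coinduced K A X) := Module.Finite.of_restrictScalars_finite K A _
  have : Module.Finite A X := Module.Finite.of_restrictScalars_finite K A _
  refine ⟨E, inferInstance, inferInstance, LinearMap.fst A _ _ ∘ₗ E.subtype, inferInstance, ?_⟩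
  intro Y _ _ _ _ _ φ
  have h1 : (∀ g : X →ₗ[A] Y, α (φ ∘ₗ g) = 0) ↔
      ∀ g : X →ₗ[A] Y, LinearMap.trace K X ((θ ∘ₗ φ.restrictScalars K) ∘ₗ
        g.restrictScalars K) = 0 :=
    forall_congr' fun g => by rw [hθ]; rfl
  rw [h1, trace_comp_eq_zero_iff_sum_commutator a]
  constructor
  · rintro ⟨η, hη⟩
    have hη' : ∀ y, θ (φ y) = ∑ i, (η i (a i • y) - a i • η i y) := fun y => by
      simpa using LinearMap.congr_fun hη y
    let f : Y → Fin (Module.finrank K A) → Coinduced K A X := fun y i =>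
      η i ∘ₗ (LinearMap.toSpanSingleton A Y y).restrictScalars K
    have hf : ∀ y i c, f y i c = η i (c • y) := fun _ _ _ => rfl
    refine ⟨{ toFun := fun y => ⟨(φ y, f y), fun c => ?_⟩
              map_add' := fun y z => ?_
              map_smul' := fun b y => ?_ }, rfl⟩
    · change θ (c • φ y) = _
      rw [← map_smul, hη']
      simp [hf, mul_smul]
    · refine Subtype.ext (Prod.ext (map_add _ _ _) ?_)
      funext i
      ext c
      simp [hf]
    · refine Subtype.ext (Prod.ext (map_smul _ _ _) ?_)
      funext i
      ext c
      simp [hf, mul_smul]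
  · rintro ⟨h, rfl⟩
    refine ⟨fun i =>
      { toFun := fun y => (h y).1.2 i 1
        map_add' := fun y z => by simp
        map_smul' := fun k y => ?_ }, ?_⟩
    · rw [← algebraMap_smul A k y, map_smul]
      simp [Algebra.algebraMap_eq_smul_one]
    · ext y
      simpa using hE (h y) 1

theorem exists_factor_left {X : Type} [AddCommGroup X] [Module K X] [Module A X]
    [IsScalarTower K A X] [FiniteDimensional K X] (α : Module.End A X →ₗ[K] K) :
    ∃ (E : Type) (_ : AddCommGroup E) (_ : Module A E) (q : X →ₗ[A] E), Module.Finite A E ∧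
      ∀ (Y : Type) [AddCommGroup Y] [Module K Y] [Module A Y] [IsScalarTower K A Y]
        [FiniteDimensional K Y] (ψ : X →ₗ[A] Y),
        (∀ g : Y →ₗ[A] X, α (g ∘ₗ ψ) = 0) ↔ ∃ h : E →ₗ[A] Y, h ∘ₗ q = ψ := by
  obtain ⟨θ, hθ⟩ := exists_trace_form α
  let a := Module.finBasis K A
  let r : X → X × (Fin (Module.finrank K A) → TensorProduct K A X) := fun x =>
    (θ x, fun i => a i ⊗ₜ x - (1 : A) ⊗ₜ[K] (a i • x))
  let N : Submodule A (X × (Fin (Module.finrank K A) → TensorProduct K A X)) :=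
    Submodule.span A (Set.range r)
  have : Module.Finite A X := Module.Finite.of_restrictScalars_finite K A _
  refine ⟨_ ⧸ N, inferInstance, inferInstance, N.mkQ ∘ₗ LinearMap.inl A _ _, inferInstance, ?_⟩
  intro Y _ _ _ _ _ ψ
  have h1 : (∀ g : Y →ₗ[A] X, α (g ∘ₗ ψ) = 0) ↔
      ∀ g : Y →ₗ[A] X, LinearMap.trace K Y ((ψ.restrictScalars K ∘ₗ θ) ∘ₗ
        g.restrictScalars K) = 0 :=
    forall_congr' fun g => by
      rw [hθ]
      exact Eq.congr_left (LinearMap.trace_comp_comm' (ψ.restrictScalars K)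
        (θ ∘ₗ g.restrictScalars K))
  rw [h1, trace_comp_eq_zero_iff_sum_commutator a]
  constructor
  · rintro ⟨η, hη⟩
    have hη' : ∀ x, ψ (θ x) = ∑ i, (η i (a i • x) - a i • η i x) := fun y => by
      simpa using LinearMap.congr_fun hη y
    let H : X × (Fin (Module.finrank K A) → TensorProduct K A X) →ₗ[A] Y :=
      ψ ∘ₗ LinearMap.fst A _ _ +
      (∑ i, TensorProduct.AlgebraTensorModule.lift
        (LinearMap.toSpanSingleton A (X →ₗ[K] Y) (η i)) ∘ₗ
          LinearMap.proj (φ := fun _ : Fin (Module.finrank K A) => TensorProduct K A X) i) ∘ₗ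
            LinearMap.snd A X _
    have hH : N ≤ LinearMap.ker H := by
      rw [Submodule.span_le]
      rintro _ ⟨x, rfl⟩
      simp [H, r, hη']
    refine ⟨N.liftQ H hH, ?_⟩
    ext x
    simp [H]
  · rintro ⟨h, rfl⟩
    let t : Fin (Module.finrank K A) → TensorProduct K A X →ₗ[A] Y := fun i =>
      h ∘ₗ N.mkQ ∘ₗ LinearMap.inr A X _ ∘ₗ
        LinearMap.single A (fun _ : Fin (Module.finrank K A) => TensorProduct K A X) i
    refine ⟨fun i => (t i).restrictScalars K ∘ₗ TensorProduct.mk K A X 1, ?_⟩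
    ext x
    have h0 : h (N.mkQ (r x)) = 0 := by
      rw [Submodule.mkQ_apply, (Submodule.Quotient.mk_eq_zero N).mpr
        (Submodule.subset_span ⟨x, rfl⟩), map_zero]
    have h2 : r x = LinearMap.inl A X _ (θ x) + LinearMap.inr A X _
        (∑ i, Pi.single i (a i ⊗ₜ x - (1 : A) ⊗ₜ[K] (a i • x))) := by
      rw [Finset.univ_sum_single]
      simp [r]
    have h3 : h (N.mkQ (r x)) = h (N.mkQ (LinearMap.inl A X _ (θ x))) +
        ∑ i, t i (a i ⊗ₜ x - (1 : A) ⊗ₜ[K] (a i • x)) := by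
      rw [h2]
      simp only [map_add, map_sum]
      rfl
    rw [h0] at h3
    have h4 : ∀ i, t i (a i ⊗ₜ x) = a i • t i ((1 : A) ⊗ₜ x) := fun i => by
      rw [← map_smul, TensorProduct.smul_tmul', smul_eq_mul, mul_one]
    have h5 := eq_neg_of_add_eq_zero_left h3.symm
    simp only [map_sub, h4, ← Finset.sum_neg_distrib, neg_sub] at h5
    simpa using h5

end AlmostFactoring

section Retracts

variable {A : Type} [Ring A]

lemma IsSubcat.retract {χ : ModuleCat.{0} A → Prop} (hsub : IsSubcat χ) {X Y : ModuleCat.{0} A}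
    (hX : χ X) (i : Y ⟶ X) (r : X ⟶ Y) (hir : i ≫ r = 𝟙 Y) : χ Y := by
  obtain ⟨Z, j, t, hjt, htj⟩ := IsIdempotentComplete.idempotents_split X (𝟙 X - r ≫ i)
    (by simp [reassoc_of% hir])
  have hit : i ≫ t = 0 := by
    have : i ≫ (t ≫ j) ≫ t = 0 := by rw [htj]; simp [reassoc_of% hir]
    simpa [hjt] using this
  have hjr : j ≫ r = 0 := by
    have : j ≫ (t ≫ j) ≫ r = 0 := by rw [htj]; simp [hir]
    simpa [reassoc_of% hjt] using this
  refine hsub.2.2.2 X Y Z ⟨biprod.lift r t, biprod.desc i j, ?_, ?_⟩ hX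
  · simp [biprod.lift_desc, htj]
  · apply biprod.hom_ext' <;> apply biprod.hom_ext <;> simp [hir, hit, hjr, hjt]

lemma Indec.isIso_of_isSplitEpi {X Y : ModuleCat.{0} A} (hY : Indec Y) (f : Y ⟶ X) (hf : f ≠ 0)
    [IsSplitEpi f] : IsIso f := by
  rcases hY.2 (f ≫ section_ f) (by simp) with h | h
  · refine absurd ?_ hf
    have : f ≫ section_ f ≫ f = 0 := by rw [reassoc_of% h, zero_comp]
    simpa using this
  · exact ⟨section_ f, h, by simp⟩

lemma Indec.isIso_of_isSplitMono {X Y : ModuleCat.{0} A} (hY : Indec Y) (f : X ⟶ Y) (hf : f ≠ 0)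
    [IsSplitMono f] : IsIso f := by
  rcases hY.2 (retraction f ≫ f) (by simp) with h | h
  · refine absurd ?_ hf
    have : (f ≫ retraction f) ≫ f = 0 := by rw [Category.assoc, h, comp_zero]
    simpa using this
  · exact ⟨retraction f, by simp, h⟩

variable [IsArtinianRing A]

lemma length_lt_of_retract {X Y : ModuleCat.{0} A} [Module.Finite A X] (i : Y ⟶ X) (r : X ⟶ Y)
    (hir : i ≫ r = 𝟙 Y) (hri : r ≫ i ≠ 𝟙 X) : Module.length A Y < Module.length A X := by
  have hl : ∀ y, r.hom (i.hom y) = y := fun y => by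
    simpa using congrArg (fun f : Y ⟶ Y => f.hom y) hir
  rw [(LinearEquiv.ofInjective i.hom (Function.LeftInverse.injective hl)).length_eq]
  refine Submodule.length_lt fun htop => hri ?_
  ext x
  obtain ⟨y, rfl⟩ := LinearMap.range_eq_top.mp htop x
  simp [hl]

/-- Fitting's lemma. -/
lemma exists_fitting {X : ModuleCat.{0} A} [Module.Finite A X] (s : X ⟶ X) :
    ∃ t e : X ⟶ X, e ≫ e = e ∧ e ≫ t = t ∧ t ≫ e = t ∧
      (∀ (W : ModuleCat.{0} A) (p : X ⟶ W), s ≫ p = p → t ≫ p = p) ∧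
      (∀ (W : ModuleCat.{0} A) (q : W ⟶ X), q ≫ s = q → q ≫ t = q) ∧
      (e = 𝟙 X → IsIso s) ∧ (e = 0 → IsIso (𝟙 X - s)) := by
  obtain ⟨n, hn, hn0⟩ := (s.hom.eventually_isCompl_ker_pow_range_pow.and
    (Filter.eventually_ge_atTop 1)).exists
  have hc := hn.symm
  let T : Module.End A X := s.hom ^ n
  let e : X →ₗ[A] X := Submodule.projection _ _ hc
  have hs : ∀ x, s.hom x = (s : X ⟶ X) x := fun _ => rfl
  have heT : ∀ x, e (T x) = T x := fun x => Submodule.projection_apply_of_mem_left hc ⟨x, rfl⟩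
  have hTe : ∀ x, T (e x) = T x := fun x => by
    have hx : x - e x ∈ LinearMap.ker T := by
      rw [← Submodule.projection_eq_self_sub_projection hc]
      exact Submodule.projection_apply_mem _ _
    exact (sub_eq_zero.mp (by simpa using hx)).symm
  refine ⟨ModuleCat.ofHom T, ModuleCat.ofHom e, ?_, ?_, ?_, ?_, ?_, ?_, ?_⟩
  · ext x
    exact Submodule.projection_apply_of_mem_left hc (Submodule.projection_apply_mem _ _)
  · ext x
    exact hTe x
  · ext x
    exact heT x
  · intro W p hp
    ext x
    change p.hom ((s.hom ^ n) x) = p.hom x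
    have hp' : ∀ y, p.hom (s.hom y) = p.hom y := fun y =>
      congrArg (fun f : X ⟶ W => f.hom y) hp
    clear * - hp'
    induction n with
    | zero => rfl
    | succ k ih => rw [pow_succ', Module.End.mul_apply, hp', ih]
  · intro W q hq
    ext x
    change (s.hom ^ n) (q.hom x) = q.hom x
    have hq' : s.hom (q.hom x) = q.hom x := congrArg (fun f : W ⟶ X => f.hom x) hq
    clear * - hq'
    induction n with
    | zero => rfl
    | succ k ih => rw [pow_succ, Module.End.mul_apply, hq', ih]
  · intro he
    have he' : ∀ x, e x = x := fun x => congrArg (fun f : X ⟶ X => f.hom x) he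
    have hinj : Function.Injective T := by
      rw [← LinearMap.ker_eq_bot, ← Submodule.ker_projection hc]
      exact LinearMap.ker_eq_bot.mpr fun x y h => by rwa [← he' x, ← he' y]
    have hinj' : Function.Injective s.hom := by
      obtain ⟨k, rfl⟩ := Nat.exists_eq_add_of_le' hn0
      intro x y h
      refine hinj ?_
      change (s.hom ^ (k + 1)) x = (s.hom ^ (k + 1)) y
      rw [pow_succ, Module.End.mul_apply, Module.End.mul_apply, h]
    rw [ConcreteCategory.isIso_iff_bijective]
    exact ⟨hinj', IsArtinian.surjective_of_injective_endomorphism s.hom hinj'⟩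
  · intro he
    have he' : ∀ x, e x = 0 := fun x => congrArg (fun f : X ⟶ X => f.hom x) he
    have hnil : IsNilpotent s.hom := ⟨n, LinearMap.ext fun x => by
      rw [LinearMap.zero_apply, ← he' (T x)]
      exact (heT x).symm⟩
    rw [ConcreteCategory.isIso_iff_bijective]
    exact (Module.End.isUnit_iff _).mp (IsNilpotent.isUnit_one_sub hnil)

lemma Indec.isIso_or_isIso_one_sub {X : ModuleCat.{0} A} [Module.Finite A X] (hX : Indec X)
    (s : X ⟶ X) : IsIso s ∨ IsIso (𝟙 X - s) := by
  obtain ⟨t, e, he, -, -, -, -, h1, h0⟩ := exists_fitting s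
  exact (hX.2 e he).symm.imp h1 h0

/-- A nonzero composition through `E` stays nonzero through some indecomposable summand of `E`. -/
lemma exists_indec_retract {E : ModuleCat.{0} A} [Module.Finite A E] {Y W : ModuleCat.{0} A}
    (h : Y ⟶ E) (c : E ⟶ W) (hc : h ≫ c ≠ 0) :
    ∃ (X : ModuleCat.{0} A) (i : X ⟶ E) (r : E ⟶ X), i ≫ r = 𝟙 X ∧ Indec X ∧
      h ≫ r ≫ i ≫ c ≠ 0 := by
  induction hn : Module.length A E using WellFoundedLT.induction generalizing E with
  | ind n ih =>
  subst hn
  by_cases hE : Indec E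
  · exact ⟨E, 𝟙 E, 𝟙 E, by simp, hE, by simpa using hc⟩
  have hnt : Nontrivial E := by
    by_contra hsub
    rw [not_nontrivial_iff_subsingleton] at hsub
    exact hc (by ext x; simp [Subsingleton.elim (h.hom x) 0])
  have : ∃ e : E ⟶ E, e ≫ e = e ∧ e ≠ 0 ∧ e ≠ 𝟙 E := by
    by_contra hcon
    push Not at hcon
    exact hE ⟨hnt, fun e he => or_iff_not_imp_left.mpr (hcon e he)⟩
  obtain ⟨e, he, he0, he1⟩ := this
  have hsmall : ∀ f : E ⟶ E, f ≫ f = f → f ≠ 𝟙 E → h ≫ f ≫ c ≠ 0 →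
      ∃ (X : ModuleCat.{0} A) (i : X ⟶ E) (r : E ⟶ X), i ≫ r = 𝟙 X ∧ Indec X ∧
        h ≫ r ≫ i ≫ c ≠ 0 := by
    intro f hf hf1 hfc
    obtain ⟨Z, j, t, hjt, rfl⟩ := IsIdempotentComplete.idempotents_split E f hf
    have : Module.Finite A Z := Module.Finite.of_surjective t.hom fun z =>
      ⟨j.hom z, congrArg (fun f : Z ⟶ Z => f.hom z) hjt⟩
    obtain ⟨X, i, r, hir, hX, hX0⟩ := ih _ (length_lt_of_retract j t hjt hf1) (h ≫ t) (j ≫ c)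
      (by simpa using hfc) rfl
    exact ⟨X, i ≫ j, t ≫ r, by simp [reassoc_of% hjt, hir], hX, by simpa using hX0⟩
  by_cases h1 : h ≫ e ≫ c = 0
  · refine hsmall (𝟙 E - e) (by simp [he]) (by simpa using he0) ?_
    simpa [h1] using hc
  · exact hsmall e he he1 h1

end Retracts

section AlmostSplit

variable {A : Type} [Ring A] [IsArtinianRing A] {χ : ModuleCat.{0} A → Prop}

lemma exists_minimalRightAlmostSplitIn (hsub : IsSubcat χ) {X : ModuleCat.{0} A}
    (hX : ∃ (E : ModuleCat.{0} A) (p : E ⟶ X), χ E ∧ RightAlmostSplitIn χ p) :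
    ∃ (E : ModuleCat.{0} A) (p : E ⟶ X), χ E ∧ MinimalRightAlmostSplitIn χ p := by
  obtain ⟨E, p, hE, hp⟩ := hX
  induction hn : Module.length A E using WellFoundedLT.induction generalizing E with
  | ind n ih =>
  subst hn
  by_cases hmin : RightMinimal p
  · exact ⟨E, p, hE, hmin, hp⟩
  unfold RightMinimal at hmin
  push Not at hmin
  obtain ⟨s, hs, hs'⟩ := hmin
  have := hsub.1 E hE
  obtain ⟨t, e, he, het, hte, hright, -, h1, -⟩ := exists_fitting s
  obtain ⟨E', i, r, hir, rfl⟩ := IsIdempotentComplete.idempotents_split E e he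
  refine ih _ (length_lt_of_retract i r hir fun h => hs' (h1 h)) E' (i ≫ p)
    (hsub.retract hE i r hir) ⟨fun _ => hp.1 ?_, fun Z hZ g hg => ?_⟩ rfl
  · exact IsSplitEpi.mk' ⟨section_ (i ≫ p) ≫ i, by simp⟩
  · obtain ⟨h, rfl⟩ := hp.2 Z hZ g hg
    refine ⟨h ≫ t ≫ r, ?_⟩
    have := hright _ p hs
    simp only [Category.assoc] at hte ⊢
    rw [reassoc_of% hte, this]

lemma exists_minimalLeftAlmostSplitIn (hsub : IsSubcat χ) {X : ModuleCat.{0} A}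
    (hX : ∃ (E : ModuleCat.{0} A) (q : X ⟶ E), χ E ∧ LeftAlmostSplitIn χ q) :
    ∃ (E : ModuleCat.{0} A) (q : X ⟶ E), χ E ∧ MinimalLeftAlmostSplitIn χ q := by
  obtain ⟨E, q, hE, hq⟩ := hX
  induction hn : Module.length A E using WellFoundedLT.induction generalizing E with
  | ind n ih =>
  subst hn
  by_cases hmin : LeftMinimal q
  · exact ⟨E, q, hE, hmin, hq⟩
  unfold LeftMinimal at hmin
  push Not at hmin
  obtain ⟨s, hs, hs'⟩ := hmin
  have := hsub.1 E hE
  obtain ⟨t, e, he, het, hte, -, hleft, h1, -⟩ := exists_fitting s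
  obtain ⟨E', i, r, hir, rfl⟩ := IsIdempotentComplete.idempotents_split E e he
  refine ih _ (length_lt_of_retract i r hir fun h => hs' (h1 h)) E' (q ≫ r)
    (hsub.retract hE i r hir) ⟨fun _ => hq.1 ?_, fun Z hZ g hg => ?_⟩ rfl
  · exact IsSplitMono.mk' ⟨r ≫ retraction (q ≫ r), by
      rw [← Category.assoc, IsSplitMono.id]⟩
  · obtain ⟨h, rfl⟩ := hq.2 Z hZ g hg
    refine ⟨i ≫ t ≫ h, ?_⟩
    have := hleft _ q hs
    simp only [Category.assoc] at het ⊢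
    rw [reassoc_of% het, reassoc_of% this]

/-- A nonzero composition starting with a map to `X` that is not a split epimorphism factors
through an irreducible map to `X`. -/
lemma exists_irredIn_to (hsub : IsSubcat χ) {X : ModuleCat.{0} A} (hX : Indec X)
    (hras : ∃ (E : ModuleCat.{0} A) (p : E ⟶ X), χ E ∧ RightAlmostSplitIn χ p)
    {Y W : ModuleCat.{0} A} (hY : χ Y) (u : Y ⟶ X) (hu : ¬ IsSplitEpi u) (c : X ⟶ W)
    (huc : u ≫ c ≠ 0) :
    ∃ (X' : ModuleCat.{0} A) (g : X' ⟶ X) (u' : Y ⟶ X'), χ X' ∧ Indec X' ∧ IrredIn χ g ∧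
      u' ≫ g ≫ c ≠ 0 := by
  obtain ⟨E, p, hE, hmin, hp⟩ := exists_minimalRightAlmostSplitIn hsub hras
  obtain ⟨h, rfl⟩ := hp.2 Y hY u hu
  have := hsub.1 E hE
  obtain ⟨X', i, r, hir, hX', hne⟩ := exists_indec_retract h (p ≫ c) (by simpa using huc)
  have hepi : ¬ IsSplitEpi (i ≫ p) := fun _ =>
    hp.1 (IsSplitEpi.mk' ⟨section_ (i ≫ p) ≫ i, by simp⟩)
  refine ⟨X', i ≫ p, h ≫ r, hsub.retract hE i r hir, hX', ⟨fun _ => ?_, hepi, ?_⟩,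
    by simpa using hne⟩
  · have : IsIso (i ≫ p) := hX.isIso_of_isSplitMono _ fun h0 => hne (by rw [reassoc_of% h0]; simp)
    exact hepi inferInstance
  · intro Z hZ f g hfg
    refine or_iff_not_imp_right.mpr fun hg => ?_
    obtain ⟨t, rfl⟩ := hp.2 Z hZ g hg
    obtain ⟨v, hv, -⟩ := (hmin (𝟙 E - r ≫ i + r ≫ f ≫ t) (by simp [hfg])).out
    have hi : f ≫ t = i ≫ (𝟙 E - r ≫ i + r ≫ f ≫ t) := by simp [reassoc_of% hir]
    refine IsSplitMono.mk' ⟨t ≫ v ≫ r, ?_⟩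
    calc f ≫ t ≫ v ≫ r = (f ≫ t) ≫ v ≫ r := by simp
      _ = i ≫ ((𝟙 E - r ≫ i + r ≫ f ≫ t) ≫ v) ≫ r := by
        simpa only [Category.assoc] using congrArg (· ≫ v ≫ r) hi
      _ = 𝟙 X' := by rw [hv, Category.id_comp, hir]

/-- A nonzero composition ending with a map from `X` that is not a split monomorphism factors
through an irreducible map from `X`. -/
lemma exists_irredIn_from (hsub : IsSubcat χ) {X : ModuleCat.{0} A} (hX : Indec X)
    (hlas : ∃ (E : ModuleCat.{0} A) (q : X ⟶ E), χ E ∧ LeftAlmostSplitIn χ q)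
    {Y W : ModuleCat.{0} A} (hY : χ Y) (u : X ⟶ Y) (hu : ¬ IsSplitMono u) (c : W ⟶ X)
    (huc : c ≫ u ≠ 0) :
    ∃ (X' : ModuleCat.{0} A) (g : X ⟶ X') (u' : X' ⟶ Y), χ X' ∧ Indec X' ∧ IrredIn χ g ∧
      c ≫ g ≫ u' ≠ 0 := by
  obtain ⟨E, q, hE, hmin, hq⟩ := exists_minimalLeftAlmostSplitIn hsub hlas
  obtain ⟨h, rfl⟩ := hq.2 Y hY u hu
  have := hsub.1 E hE
  obtain ⟨X', i, r, hir, hX', hne⟩ := exists_indec_retract (c ≫ q) h (by simpa using huc)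
  have hmono : ¬ IsSplitMono (q ≫ r) := fun _ =>
    hq.1 (IsSplitMono.mk' ⟨r ≫ retraction (q ≫ r), by
      rw [← Category.assoc, IsSplitMono.id]⟩)
  refine ⟨X', q ≫ r, i ≫ h, hsub.retract hE i r hir, hX', ⟨hmono, fun _ => ?_, ?_⟩,
    by simpa using hne⟩
  · have : IsIso (q ≫ r) := hX.isIso_of_isSplitEpi _ fun h0 => hne (by
      rw [Category.assoc, reassoc_of% h0]; simp)
    exact hmono inferInstance
  · intro Z hZ f g hfg
    refine or_iff_not_imp_left.mpr fun hf => ?_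
    obtain ⟨t, rfl⟩ := hq.2 Z hZ f hf
    obtain ⟨v, -, hv⟩ := (hmin (𝟙 E - r ≫ i + t ≫ g ≫ i) (by
      have : q ≫ r ≫ i = q ≫ t ≫ g ≫ i := by rw [reassoc_of% hfg]
      simp [this])).out
    have hr : t ≫ g = (𝟙 E - r ≫ i + t ≫ g ≫ i) ≫ r := by simp [hir]
    refine IsSplitEpi.mk' ⟨i ≫ v ≫ t, ?_⟩
    calc (i ≫ v ≫ t) ≫ g = i ≫ v ≫ t ≫ g := by simp
      _ = i ≫ (v ≫ (𝟙 E - r ≫ i + t ≫ g ≫ i)) ≫ r := by rw [hr]; simp only [Category.assoc]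
      _ = 𝟙 X' := by rw [hv, Category.id_comp, hir]

end AlmostSplit

section HaradaSai

variable {A : Type} [Ring A]

/-- `f` is a composition of `2 ^ k` morphisms between objects satisfying `P`, interlaced with
`2 ^ k - 1` non-isomorphisms. -/
def NonIsoComposition (P : ModuleCat.{0} A → Prop) :
    ℕ → ∀ {X Y : ModuleCat.{0} A}, (X ⟶ Y) → Prop
  | 0, X, Y, _ => P X ∧ P Y
  | k + 1, X, Y, f => ∃ (Z W : ModuleCat.{0} A) (f₁ : X ⟶ Z) (g : Z ⟶ W) (f₂ : W ⟶ Y),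
      NonIsoComposition P k f₁ ∧ NonIsoComposition P k f₂ ∧ ¬ IsIso g ∧ f = f₁ ≫ g ≫ f₂

lemma NonIsoComposition.endpoints {P : ModuleCat.{0} A → Prop} {k : ℕ} {X Y : ModuleCat.{0} A}
    {f : X ⟶ Y} (hf : NonIsoComposition P k f) : P X ∧ P Y := by
  induction k generalizing X Y with
  | zero => exact hf
  | succ k ih =>
    obtain ⟨Z, W, f₁, g, f₂, h₁, h₂, -, -⟩ := hf
    exact ⟨(ih h₁).1, (ih h₂).2⟩

/-- The length of the image of `f`. -/
noncomputable def rankLength {X Y : ModuleCat.{0} A} (f : X ⟶ Y) : ℕ∞ :=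
  Module.length A (LinearMap.range f.hom)

lemma rankLength_comp_le_left {X Y Z : ModuleCat.{0} A} (f : X ⟶ Y) (g : Y ⟶ Z) :
    rankLength (f ≫ g) ≤ rankLength f := by
  refine Module.length_le_of_surjective
    (g.hom.restrict (p := LinearMap.range f.hom) (q := LinearMap.range (f ≫ g).hom) ?_) ?_
  · rintro _ ⟨x, rfl⟩
    exact ⟨x, rfl⟩
  · rintro ⟨_, x, rfl⟩
    exact ⟨⟨f.hom x, x, rfl⟩, rfl⟩

lemma rankLength_comp_le_right {X Y Z : ModuleCat.{0} A} (f : X ⟶ Y) (g : Y ⟶ Z) :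
    rankLength (f ≫ g) ≤ rankLength g :=
  Module.length_le_of_injective
    (Submodule.inclusion (LinearMap.range_comp_le_range f.hom g.hom))
    (Submodule.inclusion_injective _)

lemma Indec.eq_top_and_eq_bot_of_isCompl {Y : ModuleCat.{0} A} (hY : Indec Y)
    {p q : Submodule A Y} (h : IsCompl p q) (hp : p ≠ ⊥) : p = ⊤ ∧ q = ⊥ := by
  have he : ModuleCat.ofHom (Submodule.projection p q h) ≫
      ModuleCat.ofHom (Submodule.projection p q h) =
      ModuleCat.ofHom (Submodule.projection p q h) := by
    ext x
    exact Submodule.projection_apply_of_mem_left h (Submodule.projection_apply_mem _ _)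
  rcases hY.2 _ he with h0 | h1
  · refine absurd ?_ hp
    rw [← Submodule.range_projection h, LinearMap.range_eq_bot]
    exact congrArg ModuleCat.Hom.hom h0
  · have h1' : Submodule.projection p q h = LinearMap.id := congrArg ModuleCat.Hom.hom h1
    refine ⟨(Submodule.range_projection h).symm.trans ?_,
      (Submodule.ker_projection h).symm.trans ?_⟩
    · rw [h1', LinearMap.range_id]
    · rw [h1', LinearMap.ker_id]

variable [IsArtinianRing A]

lemma surjective_and_injective_of_rankLength_comp_eq {X Y Z : ModuleCat.{0} A}
    [Module.Finite A Y] (hY : Indec Y) (f : X ⟶ Y) (h : Y ⟶ Z) (h0 : f ≫ h ≠ 0)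
    (hf : rankLength f ≤ rankLength (f ≫ h)) (hh : rankLength h ≤ rankLength (f ≫ h)) :
    Function.Surjective f.hom ∧ Function.Injective h.hom := by
  have hrange : LinearMap.range (f ≫ h).hom = LinearMap.range h.hom := by
    have hle : LinearMap.range (f ≫ h).hom ≤ LinearMap.range h.hom :=
      LinearMap.range_comp_le_range f.hom h.hom
    have hlt : ¬ Module.length A (LinearMap.range (f ≫ h).hom) <
        Module.length A (LinearMap.range h.hom) := not_lt.mpr hh
    refine hle.antisymm (Submodule.submoduleOf_eq_top.mp (not_ne_iff.mp fun hne => hlt ?_))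
    rw [← (Submodule.submoduleOfEquivOfLe hle).length_eq]
    exact Submodule.length_lt hne
  have hdisj : Disjoint (LinearMap.range f.hom) (LinearMap.ker h.hom) := by
    let g := h.hom.domRestrict (LinearMap.range f.hom)
    have hg : LinearMap.range g = LinearMap.range (f ≫ h).hom := by
      rw [LinearMap.range_domRestrict, ModuleCat.hom_comp, LinearMap.range_comp]
    have hadd := Module.length_eq_add_of_exact (LinearMap.ker g).subtype g.rangeRestrict
      (LinearMap.ker g).subtype_injective g.surjective_rangeRestrict
      (by rw [LinearMap.exact_iff, LinearMap.ker_rangeRestrict, Submodule.range_subtype])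
    rw [hg] at hadd
    have hfin : rankLength (f ≫ h) ≠ ⊤ := by
      rw [rankLength, hrange]
      exact Module.length_ne_top
    have hker : Module.length A (LinearMap.ker g) = 0 := by
      have : Module.length A (LinearMap.ker g) + rankLength (f ≫ h) ≤ 0 + rankLength (f ≫ h) := by
        rw [zero_add]
        exact hadd.ge.trans hf
      simpa using (ENat.add_le_add_iff_right hfin).mp this
    rw [Module.length_eq_zero_iff, Submodule.subsingleton_iff_eq_bot] at hker
    rw [Submodule.disjoint_def]
    intro y hy hy0
    have : (⟨y, hy⟩ : LinearMap.range f.hom) ∈ LinearMap.ker g := hy0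
    simpa [hker] using this
  have hcodisj : Codisjoint (LinearMap.range f.hom) (LinearMap.ker h.hom) := by
    rw [codisjoint_iff, eq_top_iff]
    intro y _
    obtain ⟨x, hx⟩ : h.hom y ∈ LinearMap.range (f ≫ h).hom := hrange ▸ ⟨y, rfl⟩
    rw [Submodule.mem_sup]
    refine ⟨f.hom x, ⟨x, rfl⟩, y - f.hom x, ?_, by abel⟩
    rw [LinearMap.mem_ker, map_sub, sub_eq_zero]
    exact hx.symm
  rw [← LinearMap.range_eq_top, ← LinearMap.ker_eq_bot]
  refine hY.eq_top_and_eq_bot_of_isCompl ⟨hdisj, hcodisj⟩ fun hbot => h0 ?_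
  have : f = 0 := ModuleCat.hom_ext (LinearMap.range_eq_bot.mp hbot)
  rw [this, zero_comp]

/-- The Harada–Sai lemma. -/
lemma NonIsoComposition.rankLength_add_le {P : ModuleCat.{0} A → Prop} {b : ℕ}
    (hP : ∀ X, P X → Indec X ∧ Module.Finite A X ∧ Module.length A X ≤ b) {k : ℕ}
    {X Y : ModuleCat.{0} A} {f : X ⟶ Y} (hf : NonIsoComposition P k f) (h0 : f ≠ 0) :
    rankLength f + k ≤ b := by
  induction k generalizing X Y with
  | zero =>
    have := Module.length_le_of_injective _ (LinearMap.range f.hom).subtype_injective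
    simpa [rankLength] using this.trans (hP Y hf.2).2.2
  | succ k ih =>
    obtain ⟨Z, W, f₁, g, f₂, h₁, h₂, hg, rfl⟩ := hf
    have l₁ := ih h₁ fun h => h0 (by simp [h])
    have l₂ := ih h₂ fun h => h0 (by simp [h])
    by_contra hcon
    have key : ∀ m : ℕ∞, m + k ≤ b → m ≤ rankLength (f₁ ≫ g ≫ f₂) := by
      intro m hm
      generalize rankLength (f₁ ≫ g ≫ f₂) = n at hcon ⊢
      by_contra hlt
      refine hcon (le_trans ?_ hm)
      rw [Nat.cast_succ, add_comm (k : ℕ∞), ← add_assoc]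
      gcongr
      exact Order.add_one_le_of_lt (not_le.mp hlt)
    obtain ⟨hZ, _, -⟩ := hP Z h₁.endpoints.2
    obtain ⟨hW, _, -⟩ := hP W h₂.endpoints.1
    have hinj := (surjective_and_injective_of_rankLength_comp_eq hZ f₁ (g ≫ f₂) h0 (key _ l₁)
      ((rankLength_comp_le_right g f₂).trans (key _ l₂))).2
    have hsurj := (surjective_and_injective_of_rankLength_comp_eq hW (f₁ ≫ g) f₂
      (by simpa using h0)
      (by simpa using (rankLength_comp_le_left f₁ g).trans (key _ l₁))
      (by simpa using key _ l₂)).1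
    refine hg ((ConcreteCategory.isIso_iff_bijective g).mpr ⟨?_, ?_⟩)
    · exact Function.Injective.of_comp (f := f₂.hom) hinj
    · exact Function.Surjective.of_comp (g := f₁.hom) hsurj

lemma NonIsoComposition.eq_zero {P : ModuleCat.{0} A → Prop} {b : ℕ}
    (hP : ∀ X, P X → Indec X ∧ Module.Finite A X ∧ Module.length A X ≤ b)
    {X Y : ModuleCat.{0} A} {f : X ⟶ Y} (hf : NonIsoComposition P (b + 1) f) : f = 0 := by
  by_contra h0
  have h := hf.rankLength_add_le hP h0
  have : ((b + 1 : ℕ) : ℕ∞) ≤ b := le_add_self.trans h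
  exact absurd (Nat.cast_le.mp this) (by simp)

end HaradaSai

section Existence

variable {A : Type} [Ring A]

lemma Indec.exists_functional {X : ModuleCat.{0} A} [Module.Finite A X] (hX : Indec X)
    (K : Type) [Field K] [Algebra K A] [FiniteDimensional K A] [Module K X] [IsScalarTower K A X] :
    ∃ α : Module.End A X →ₗ[K] K, ∀ s : X ⟶ X,
      (¬ IsIso s → α s.hom = 0) ∧ (s = 𝟙 X → α s.hom ≠ 0) := by
  have : IsArtinianRing A := IsArtinianRing.of_finite K A
  have hunit : ∀ s : X ⟶ X, IsUnit (s.hom : Module.End A X) ↔ IsIso s := fun s => by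
    rw [Module.End.isUnit_iff, ConcreteCategory.isIso_iff_bijective]
  have : Nontrivial X := hX.1
  have : IsLocalRing (Module.End A X) := IsLocalRing.of_isUnit_or_isUnit_one_sub_self fun s =>
    (hX.isIso_or_isIso_one_sub (ModuleCat.ofHom s)).imp (hunit _).mpr (hunit _).mpr
  let N : Submodule K (Module.End A X) :=
    { IsLocalRing.nonunitsAddSubmonoid (Module.End A X) with
      smul_mem' := fun k s (hs : ¬ IsUnit s) => show ¬ IsUnit (k • s) by
        rcases eq_or_ne k 0 with rfl | hk
        · simp
        · exact fun h => hs ((isUnit_smul_iff (Units.mk0 k hk) s).mp h) }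
  obtain ⟨α, hα, hN⟩ := Submodule.exists_le_ker_of_notMem (p := N) (v := 1)
    fun h : ¬ IsUnit (1 : Module.End A X) => h isUnit_one
  refine ⟨α, fun s => ⟨fun hs => hN (show ¬ IsUnit s.hom from (hunit s).not.mpr hs), ?_⟩⟩
  rintro rfl
  exact hα

lemma Indec.exists_rightAlmostSplitIn_finite {X : ModuleCat.{0} A} [Module.Finite A X]
    (hX : Indec X) (K : Type) [Field K] [Algebra K A] [FiniteDimensional K A] :
    ∃ (E : ModuleCat.{0} A) (p : E ⟶ X), Module.Finite A E ∧
      RightAlmostSplitIn (fun Z => Module.Finite A Z) p := by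
  let (Z : ModuleCat.{0} A) : Module K Z := Module.compHom Z (algebraMap K A)
  have (Z : ModuleCat.{0} A) : IsScalarTower K A Z :=
    ⟨fun k a z => by rw [Algebra.smul_def, mul_smul]; rfl⟩
  have hfin (Z : ModuleCat.{0} A) [Module.Finite A Z] : FiniteDimensional K Z :=
    Module.Finite.trans A Z
  have := hfin X
  obtain ⟨α, hα⟩ := hX.exists_functional K
  have hsplit : ∀ {Y : ModuleCat.{0} A} (φ : Y ⟶ X),
      (∀ g : X →ₗ[A] Y, α (φ.hom ∘ₗ g) = 0) ↔ ¬ IsSplitEpi φ := by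
    refine fun φ => ⟨fun h _ => ?_, fun h g => (hα (ModuleCat.ofHom g ≫ φ)).1 fun _ => h ?_⟩
    · exact (hα (section_ φ ≫ φ)).2 (by simp) (h (section_ φ).hom)
    · exact IsSplitEpi.mk' ⟨inv (ModuleCat.ofHom g ≫ φ) ≫ ModuleCat.ofHom g, by simp⟩
  obtain ⟨E, _, _, p, hE, hp⟩ := exists_factor_right α
  have hp' : ∀ {Y : ModuleCat.{0} A} [Module.Finite A Y] (φ : Y ⟶ X),
      ¬ IsSplitEpi φ ↔ ∃ h : Y →ₗ[A] E, p ∘ₗ h = φ.hom := fun {Y} _ φ => by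
    have := hfin Y
    rw [← hsplit, hp]
  refine ⟨ModuleCat.of A E, ModuleCat.ofHom p, hE, ?_, fun Z hZ g hg => ?_⟩
  · have : Module.Finite A (ModuleCat.of A E) := hE
    exact (hp' _).mpr ⟨LinearMap.id, rfl⟩
  · obtain ⟨h, hh⟩ := (hp' g).mp hg
    exact ⟨ModuleCat.ofHom h, ModuleCat.hom_ext hh⟩

lemma Indec.exists_leftAlmostSplitIn_finite {X : ModuleCat.{0} A} [Module.Finite A X]
    (hX : Indec X) (K : Type) [Field K] [Algebra K A] [FiniteDimensional K A] :
    ∃ (E : ModuleCat.{0} A) (q : X ⟶ E), Module.Finite A E ∧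
      LeftAlmostSplitIn (fun Z => Module.Finite A Z) q := by
  let (Z : ModuleCat.{0} A) : Module K Z := Module.compHom Z (algebraMap K A)
  have (Z : ModuleCat.{0} A) : IsScalarTower K A Z :=
    ⟨fun k a z => by rw [Algebra.smul_def, mul_smul]; rfl⟩
  have hfin (Z : ModuleCat.{0} A) [Module.Finite A Z] : FiniteDimensional K Z :=
    Module.Finite.trans A Z
  have := hfin X
  obtain ⟨α, hα⟩ := hX.exists_functional K
  have hsplit : ∀ {Y : ModuleCat.{0} A} (ψ : X ⟶ Y),
      (∀ g : Y →ₗ[A] X, α (g ∘ₗ ψ.hom) = 0) ↔ ¬ IsSplitMono ψ := by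
    refine fun ψ => ⟨fun h _ => ?_, fun h g => (hα (ψ ≫ ModuleCat.ofHom g)).1 fun _ => h ?_⟩
    · exact (hα (ψ ≫ retraction ψ)).2 (by simp) (h (retraction ψ).hom)
    · exact IsSplitMono.mk' ⟨ModuleCat.ofHom g ≫ inv (ψ ≫ ModuleCat.ofHom g), by
        rw [← Category.assoc, IsIso.hom_inv_id]⟩
  obtain ⟨E, _, _, q, hE, hq⟩ := exists_factor_left α
  have hq' : ∀ {Y : ModuleCat.{0} A} [Module.Finite A Y] (ψ : X ⟶ Y),
      ¬ IsSplitMono ψ ↔ ∃ h : E →ₗ[A] Y, h ∘ₗ q = ψ.hom := fun {Y} _ ψ => by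
    have := hfin Y
    rw [← hsplit, hq]
  refine ⟨ModuleCat.of A E, ModuleCat.ofHom q, hE, ?_, fun Z hZ g hg => ?_⟩
  · have : Module.Finite A (ModuleCat.of A E) := hE
    exact (hq' _).mpr ⟨LinearMap.id, rfl⟩
  · obtain ⟨h, hh⟩ := (hq' g).mp hg
    exact ⟨ModuleCat.ofHom h, ModuleCat.hom_ext hh⟩

variable {χ : ModuleCat.{0} A → Prop}

lemma ContravariantlyFinite.exists_rightAlmostSplitIn (hff : ContravariantlyFinite χ)
    (hsub : IsSubcat χ) {X : ModuleCat.{0} A} [Module.Finite A X] (hX : Indec X)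
    (K : Type) [Field K] [Algebra K A] [FiniteDimensional K A] :
    ∃ (E : ModuleCat.{0} A) (p : E ⟶ X), χ E ∧ RightAlmostSplitIn χ p := by
  obtain ⟨F, p, hF, hp⟩ := hX.exists_rightAlmostSplitIn_finite K
  obtain ⟨E, f, hE, hf⟩ := hff F hF
  refine ⟨E, f ≫ p, hE, fun _ => hp.1 ?_, fun Z hZ g hg => ?_⟩
  · exact IsSplitEpi.mk' ⟨section_ (f ≫ p) ≫ f, by simp⟩
  · obtain ⟨h, rfl⟩ := hp.2 Z (hsub.1 Z hZ) g hg
    obtain ⟨t, rfl⟩ := hf Z hZ h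
    exact ⟨t, by simp⟩

lemma CovariantlyFinite.exists_leftAlmostSplitIn (hff : CovariantlyFinite χ)
    (hsub : IsSubcat χ) {X : ModuleCat.{0} A} [Module.Finite A X] (hX : Indec X)
    (K : Type) [Field K] [Algebra K A] [FiniteDimensional K A] :
    ∃ (E : ModuleCat.{0} A) (q : X ⟶ E), χ E ∧ LeftAlmostSplitIn χ q := by
  obtain ⟨F, q, hF, hq⟩ := hX.exists_leftAlmostSplitIn_finite K
  obtain ⟨E, f, hE, hf⟩ := hff F hF
  refine ⟨E, q ≫ f, hE, fun _ => hq.1 ?_, fun Z hZ g hg => ?_⟩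
  · exact IsSplitMono.mk' ⟨f ≫ retraction (q ≫ f), by rw [← Category.assoc, IsSplitMono.id]⟩
  · obtain ⟨h, rfl⟩ := hq.2 Z (hsub.1 Z hZ) g hg
    obtain ⟨t, rfl⟩ := hf Z hZ h
    exact ⟨t, by simp⟩

end Existence

section Component

variable {A : Type} [Ring A]

lemma exists_nonIsoComposition_to {P : ModuleCat.{0} A → Prop} {Y : ModuleCat.{0} A}
    (hstep : ∀ (X W : ModuleCat.{0} A) (c : X ⟶ W) (u : Y ⟶ X), P X → u ≫ c ≠ 0 →
      ∃ (X' : ModuleCat.{0} A) (g : X' ⟶ X) (u' : Y ⟶ X'), P X' ∧ ¬ IsIso g ∧ u' ≫ g ≫ c ≠ 0)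
    (k : ℕ) {X W : ModuleCat.{0} A} (c : X ⟶ W) (u : Y ⟶ X) (hX : P X) (huc : u ≫ c ≠ 0) :
    ∃ (X' : ModuleCat.{0} A) (f : X' ⟶ X) (u' : Y ⟶ X'),
      NonIsoComposition P k f ∧ u' ≫ f ≫ c ≠ 0 := by
  induction k generalizing X W with
  | zero => exact ⟨X, 𝟙 X, u, ⟨hX, hX⟩, by simpa using huc⟩
  | succ k ih =>
    obtain ⟨X₁, f₂, u₁, hf₂, h₁⟩ := ih c u hX huc
    obtain ⟨X₂, g, u₂, hX₂, hg, h₂⟩ := hstep X₁ W (f₂ ≫ c) u₁ hf₂.endpoints.1 h₁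
    obtain ⟨X₃, f₁, u₃, hf₁, h₃⟩ := ih (g ≫ f₂ ≫ c) u₂ hX₂ h₂
    exact ⟨X₃, f₁ ≫ g ≫ f₂, u₃, ⟨X₂, X₁, f₁, g, f₂, hf₁, hf₂, hg, rfl⟩, by simpa using h₃⟩

lemma exists_nonIsoComposition_from {P : ModuleCat.{0} A → Prop} {Y : ModuleCat.{0} A}
    (hstep : ∀ (X W : ModuleCat.{0} A) (c : W ⟶ X) (u : X ⟶ Y), P X → c ≫ u ≠ 0 →
      ∃ (X' : ModuleCat.{0} A) (g : X ⟶ X') (u' : X' ⟶ Y), P X' ∧ ¬ IsIso g ∧ c ≫ g ≫ u' ≠ 0)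
    (k : ℕ) {X W : ModuleCat.{0} A} (c : W ⟶ X) (u : X ⟶ Y) (hX : P X) (huc : c ≫ u ≠ 0) :
    ∃ (X' : ModuleCat.{0} A) (f : X ⟶ X') (u' : X' ⟶ Y),
      NonIsoComposition P k f ∧ c ≫ f ≫ u' ≠ 0 := by
  induction k generalizing X W with
  | zero => exact ⟨X, 𝟙 X, u, ⟨hX, hX⟩, by simpa using huc⟩
  | succ k ih =>
    obtain ⟨X₁, f₁, u₁, hf₁, h₁⟩ := ih c u hX huc
    obtain ⟨X₂, g, u₂, hX₂, hg, h₂⟩ := hstep X₁ W (c ≫ f₁) u₁ hf₁.endpoints.2 (by simpa using h₁)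
    obtain ⟨X₃, f₂, u₃, hf₂, h₃⟩ := ih ((c ≫ f₁) ≫ g) u₂ hX₂ (by simpa using h₂)
    exact ⟨X₃, f₁ ≫ g ≫ f₂, u₃, ⟨X₁, X₂, f₁, g, f₂, hf₁, hf₂, hg, rfl⟩, by simpa using h₃⟩

variable {χ : ModuleCat.{0} A → Prop} {Γ : Set (ModuleCat.{0} A)}

/-- `Γ` is a union of connected components of the Auslander–Reiten quiver of `χ`, and the modules
in `Γ` have length at most `b`. -/
structure IsBoundedARClosed (χ : ModuleCat.{0} A → Prop) (Γ : Set (ModuleCat.{0} A)) (b : ℕ) :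
    Prop where
  mem : ∀ X ∈ Γ, χ X
  indec : ∀ X ∈ Γ, Indec X
  step : ∀ X ∈ Γ, ∀ Y, ARStep χ X Y → Y ∈ Γ
  length_le : ∀ X ∈ Γ, Module.length A X ≤ b

namespace IsBoundedARClosed

variable {b : ℕ}

lemma mem_of_iso (hΓ : IsBoundedARClosed χ Γ b) {X Y : ModuleCat.{0} A} (hX : X ∈ Γ)
    (hY : χ Y) (hYi : Indec Y) (e : X ≅ Y) : Y ∈ Γ :=
  hΓ.step X hX Y ⟨hΓ.mem X hX, hY, hΓ.indec X hX, hYi, .inr (.inr ⟨e⟩)⟩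

lemma mem_of_hom_to (hΓ : IsBoundedARClosed χ Γ b) (K : Type) [Field K] [Algebra K A]
    [FiniteDimensional K A] (hsub : IsSubcat χ) (hff : ContravariantlyFinite χ)
    {X Y : ModuleCat.{0} A} (hX : X ∈ Γ) (hY : χ Y) (hYi : Indec Y) (u : Y ⟶ X) (hu : u ≠ 0) :
    Y ∈ Γ := by
  have : IsArtinianRing A := IsArtinianRing.of_finite K A
  by_contra hYΓ
  obtain ⟨X', f, u', hf, h⟩ := exists_nonIsoComposition_to (P := (· ∈ Γ)) (Y := Y)
    (fun X W c u hX huc => by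
      have := hsub.1 X (hΓ.mem X hX)
      have hepi : ¬ IsSplitEpi u := fun _ => by
        have := hYi.isIso_of_isSplitEpi u fun h => huc (by rw [h, zero_comp])
        exact hYΓ (hΓ.mem_of_iso hX hY hYi (asIso u).symm)
      obtain ⟨X', g, u', hX', hXi', hg, hne⟩ := exists_irredIn_to hsub (hΓ.indec X hX)
        (hff.exists_rightAlmostSplitIn hsub (hΓ.indec X hX) K) hY u hepi c huc
      exact ⟨X', g, u', hΓ.step X hX X' ⟨hΓ.mem X hX, hX', hΓ.indec X hX, hXi',
        .inr (.inl ⟨g, hg⟩)⟩, fun _ => hg.2.1 inferInstance, hne⟩)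
    (b + 1) (𝟙 X) u hX (by simpa using hu)
  refine h ?_
  rw [hf.eq_zero fun X hX => ⟨hΓ.indec X hX, hsub.1 X (hΓ.mem X hX), hΓ.length_le X hX⟩]
  simp

lemma mem_of_hom_from (hΓ : IsBoundedARClosed χ Γ b) (K : Type) [Field K] [Algebra K A]
    [FiniteDimensional K A] (hsub : IsSubcat χ) (hff : CovariantlyFinite χ)
    {X Y : ModuleCat.{0} A} (hX : X ∈ Γ) (hY : χ Y) (hYi : Indec Y) (u : X ⟶ Y) (hu : u ≠ 0) :
    Y ∈ Γ := by
  have : IsArtinianRing A := IsArtinianRing.of_finite K A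
  by_contra hYΓ
  obtain ⟨X', f, u', hf, h⟩ := exists_nonIsoComposition_from (P := (· ∈ Γ)) (Y := Y)
    (fun X W c u hX huc => by
      have := hsub.1 X (hΓ.mem X hX)
      have hmono : ¬ IsSplitMono u := fun _ => by
        have := hYi.isIso_of_isSplitMono u fun h => huc (by rw [h, comp_zero])
        exact hYΓ (hΓ.mem_of_iso hX hY hYi (asIso u))
      obtain ⟨X', g, u', hX', hXi', hg, hne⟩ := exists_irredIn_from hsub (hΓ.indec X hX)
        (hff.exists_leftAlmostSplitIn hsub (hΓ.indec X hX) K) hY u hmono c huc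
      exact ⟨X', g, u', hΓ.step X hX X' ⟨hΓ.mem X hX, hX', hΓ.indec X hX, hXi',
        .inl ⟨g, hg⟩⟩, fun _ => hg.1 inferInstance, hne⟩)
    (b + 1) (𝟙 X) u hX (by simpa using hu)
  refine h ?_
  rw [hf.eq_zero fun X hX => ⟨hΓ.indec X hX, hsub.1 X (hΓ.mem X hX), hΓ.length_le X hX⟩]
  simp

end IsBoundedARClosed

end Component

section Idempotents

variable {A : Type} [Ring A]

lemma projective_span_singleton {e : A} (he : e * e = e) :
    Projective (ModuleCat.of A (Ideal.span {e})) := by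
  rw [← IsProjective.iff_projective]
  refine Module.Projective.of_split (Submodule.subtype _)
    ((LinearMap.toSpanSingleton A A e).codRestrict (Ideal.span {e}) fun a =>
      Ideal.mem_span_singleton'.mpr ⟨a, rfl⟩) ?_
  ext ⟨x, hx⟩
  obtain ⟨a, rfl⟩ := Ideal.mem_span_singleton'.mp hx
  simp [mul_assoc, he]

lemma exists_hom_of_smul_ne_zero (e : A) {X : ModuleCat.{0} A} (x : X) (hx : e • x ≠ 0) :
    ∃ u : ModuleCat.of A (Ideal.span {e}) ⟶ X, u ≠ 0 := by
  refine ⟨ModuleCat.ofHom (LinearMap.toSpanSingleton A X x ∘ₗ Submodule.subtype _),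
    fun h => hx ?_⟩
  exact congrArg (fun f : ModuleCat.of A (Ideal.span {e}) ⟶ X =>
    f.hom ⟨e, Ideal.mem_span_singleton_self e⟩) h

lemma indec_span_singleton {e : A} (he : e * e = e) (he0 : e ≠ 0)
    (h : ∀ f, f * f = f → e * f = f → f * e = f → f = 0 ∨ f = e) :
    Indec (ModuleCat.of A (Ideal.span {e})) := by
  have hmem := Ideal.mem_span_singleton_self e
  refine ⟨⟨⟨e, hmem⟩, 0, fun h0 => he0 (congrArg Subtype.val h0)⟩, fun φ hφ => ?_⟩
  let ε : Ideal.span {e} := ⟨e, hmem⟩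
  let φ' : Ideal.span {e} →ₗ[A] Ideal.span {e} := φ.hom
  have hφ' : ∀ x, φ' (φ' x) = φ' x := fun x =>
    congrArg (fun f : ModuleCat.of A (Ideal.span {e}) ⟶ _ => f.hom x) hφ
  have hsmul : ∀ x : Ideal.span {e}, x.1 • ε = x := by
    rintro ⟨x, hx⟩
    obtain ⟨a, rfl⟩ := Ideal.mem_span_singleton'.mp hx
    exact Subtype.ext (by simp [ε, mul_assoc, he])
  have hval : ∀ x, φ' x = x.1 • φ' ε := fun x => by rw [← map_smul, hsmul]
  rcases h (φ' ε) (congrArg Subtype.val ((hval (φ' ε)).symm.trans (hφ' ε)))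
    (congrArg Subtype.val (hval ε).symm) (congrArg Subtype.val (hsmul (φ' ε))) with h0 | h1
  · left
    refine ModuleCat.hom_ext (LinearMap.ext fun x => ?_)
    change φ' x = 0
    rw [hval, show φ' ε = 0 from Subtype.ext h0, smul_zero]
  · right
    refine ModuleCat.hom_ext (LinearMap.ext fun x => ?_)
    change φ' x = x
    rw [hval, show φ' ε = ε from Subtype.ext h1, hsmul]

/-- An additive subgroup containing the primitive idempotents contains all idempotents. -/
lemma idempotent_mem [IsArtinianRing A] (T : AddSubgroup A)
    (hT : ∀ e : A, e * e = e → Indec (ModuleCat.of A (Ideal.span {e})) → e ∈ T) {e : A}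
    (he : e * e = e) : e ∈ T := by
  induction hI : Ideal.span {e} using WellFoundedLT.induction generalizing e with
  | ind I ih =>
  subst hI
  by_cases he0 : e = 0
  · exact he0 ▸ T.zero_mem
  by_cases h : ∀ f, f * f = f → e * f = f → f * e = f → f = 0 ∨ f = e
  · exact hT e he (indec_span_singleton he he0 h)
  push Not at h
  obtain ⟨f, hff, hef, hfe, hf0, hf1⟩ := h
  have hlt : ∀ f, f * f = f → e * f = f → f * e = f → f ≠ e → f ∈ T := by
    intro f hff hef hfe hf
    refine ih _ (lt_of_le_not_ge ?_ fun hle => hf ?_) hff rfl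
    · rw [Ideal.span_singleton_le_iff_mem]
      exact Ideal.mem_span_singleton'.mpr ⟨f, hfe⟩
    · obtain ⟨a, ha⟩ := Ideal.mem_span_singleton'.mp (hle (Ideal.mem_span_singleton_self e))
      rw [← hef, ← ha, mul_assoc, hff]
  rw [← add_sub_cancel f e]
  refine T.add_mem (hlt f hff hef hfe hf1) (hlt (e - f) ?_ ?_ ?_ (by simpa using hf0)) <;>
    simp [mul_sub, sub_mul, he, hef, hfe, hff]

/-- The elements of `A` annihilating all modules satisfying `P`. -/
def commonAnnihilator (P : ModuleCat.{0} A → Prop) : Ideal A :=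
  ⨅ (X : ModuleCat.{0} A) (_ : P X), Module.annihilator A X

lemma mem_commonAnnihilator {P : ModuleCat.{0} A → Prop} {a : A} :
    a ∈ commonAnnihilator P ↔ ∀ X : ModuleCat.{0} A, P X → ∀ x : X, a • x = 0 := by
  simp only [commonAnnihilator, Submodule.mem_iInf, Module.mem_annihilator]

lemma mul_mem_commonAnnihilator {P : ModuleCat.{0} A → Prop} {a : A}
    (ha : a ∈ commonAnnihilator P) (c : A) : a * c ∈ commonAnnihilator P := by
  rw [mem_commonAnnihilator] at ha ⊢
  intro X hX x
  rw [mul_smul, ha X hX]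

/-- Complementary two-sided ideals are generated by a central idempotent. -/
lemma exists_central_idempotent {U V : Ideal A} (hU : ∀ u ∈ U, ∀ a, u * a ∈ U)
    (hV : ∀ v ∈ V, ∀ a, v * a ∈ V) (h : IsCompl U V) :
    ∃ u ∈ U, 1 - u ∈ V ∧ u * u = u ∧ ∀ a, a * u = u * a := by
  obtain ⟨u, hu, v, hv, huv⟩ := Submodule.mem_sup.mp
    
    
    
    (h.sup_eq_top ▸ Submodule.mem_top (x := (1 : A)))
  have h0 : ∀ x ∈ U, x ∈ V → x = 0 := Submodule.disjoint_def.mp h.disjoint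
  have h₁ : ∀ a, u * a * v = 0 := fun a => h0 _ (hU _ (hU _ hu a) v) (V.mul_mem_left _ hv)
  have h₂ : ∀ a, v * a * u = 0 := fun a => h0 _ (U.mul_mem_left _ hu) (hV _ (hV _ hv a) u)
  obtain rfl : v = 1 - u := eq_sub_of_add_eq' huv
  have h₃ : ∀ a, u * a = u * a * u := fun a => by
    simpa [mul_sub, sub_eq_zero] using h₁ a
  refine ⟨u, hu, hv, ?_, fun a => ?_⟩
  · simpa using (h₃ 1).symm
  · rw [h₃ a]
    simpa [sub_mul, sub_eq_zero] using h₂ a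

end Idempotents

/-- A nonempty union of components of bounded length of the Auslander–Reiten quiver of `χ` contains
every indecomposable module in `χ`, if the algebra is indecomposable. -/
theorem IsBoundedARClosed.mem_of_indec (K : Type) [Field K] {A : Type} [Ring A] [Algebra K A]
    [FiniteDimensional K A]
    (hA : ∀ e : A, (∀ a : A, a * e = e * a) → e * e = e → e = 0 ∨ e = 1)
    {χ : ModuleCat.{0} A → Prop} {Γ : Set (ModuleCat.{0} A)} {b : ℕ}
    (hΓ : IsBoundedARClosed χ Γ b) (hsub : IsSubcat χ) (hff : FunctoriallyFinite χ)
    (hproj : ContainsProjectives χ) (hne : Γ.Nonempty) {Y : ModuleCat.{0} A} (hY : χ Y)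
    (hYi : Indec Y) : Y ∈ Γ := by
  have : IsArtinianRing A := IsArtinianRing.of_finite K A
  let U := commonAnnihilator fun Y : ModuleCat.{0} A => χ Y ∧ Indec Y ∧ Y ∉ Γ
  let V := commonAnnihilator fun X : ModuleCat.{0} A => X ∈ Γ
  have hχ : ∀ e : A, e * e = e → χ (ModuleCat.of A (Ideal.span {e})) := fun e he =>
    hproj _ (Module.Finite.iff_fg.mpr ⟨{e}, by simp⟩) (projective_span_singleton he)
  have hUV : IsCompl U V := by
    refine ⟨Submodule.disjoint_def.mpr fun a haU haV => ?_, codisjoint_iff.mpr ?_⟩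
    · have : (1 : A) ∈ (AddMonoidHom.mulLeft a).ker := by
        refine idempotent_mem _ (fun e he hi => ?_) (mul_one 1)
        have hkill : ∀ x : ModuleCat.of A (Ideal.span {e}), a • x = 0 := by
          by_cases hP : ModuleCat.of A (Ideal.span {e}) ∈ Γ
          · exact mem_commonAnnihilator.mp haV _ hP
          · exact mem_commonAnnihilator.mp haU _ ⟨hχ e he, hi, hP⟩
        exact congrArg Subtype.val (hkill ⟨e, Ideal.mem_span_singleton_self e⟩)
      simpa using this
    · refine (Ideal.eq_top_iff_one _).mpr
        (idempotent_mem (U ⊔ V).toAddSubgroup (fun e he hi => ?_) (mul_one 1))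
      by_cases hP : ModuleCat.of A (Ideal.span {e}) ∈ Γ
      · refine Submodule.mem_sup_left (mem_commonAnnihilator.mpr fun Y hY y => ?_)
        by_contra hy
        obtain ⟨u, hu⟩ := exists_hom_of_smul_ne_zero e y hy
        exact hY.2.2 (hΓ.mem_of_hom_from K hsub hff.2 hP hY.1 hY.2.1 u hu)
      · refine Submodule.mem_sup_right (mem_commonAnnihilator.mpr fun X hX x => ?_)
        by_contra hx
        obtain ⟨u, hu⟩ := exists_hom_of_smul_ne_zero e x hx
        exact hP (hΓ.mem_of_hom_to K hsub hff.1 hX (hχ e he) hi u hu)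
  have hnt : ∀ {P : ModuleCat.{0} A → Prop} {X : ModuleCat.{0} A}, P X → Indec X →
      1 ∉ commonAnnihilator P := fun {P X} hP hX h => by
    obtain ⟨x, hx⟩ := @exists_ne X hX.1 0
    exact hx (by simpa using mem_commonAnnihilator.mp h X hP x)
  obtain ⟨u, hu, hv, huu, hcent⟩ := exists_central_idempotent
    (fun _ => mul_mem_commonAnnihilator) (fun _ => mul_mem_commonAnnihilator) hUV
  rcases hA u hcent huu with rfl | rfl
  · obtain ⟨X, hX⟩ := hne
    exact absurd (by simpa using hv) (hnt (P := (· ∈ Γ)) hX (hΓ.indec X hX))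
  · by_contra hYΓ
    exact hnt ⟨hY, hYi, hYΓ⟩ hYi hu

/-!
Statement 9: if `A` is an indecomposable algebra and a connected component `Γ` of the
Auslander–Reiten quiver of `χ` has bounded lengths, then every indecomposable module of
`χ` is isomorphic to a module in `Γ`.
-/

theorem stmt_9 {K : Type} [Field K] [IsAlgClosed K]
    {A : Type} [Ring A] [Algebra K A] [FiniteDimensional K A]
    -- `A` is an indecomposable algebra: its only central idempotents are `0` and `1`
    (hA : ∀ e : A, (∀ a : A, a * e = e * a) → e * e = e → e = 0 ∨ e = 1)
    (χ : ModuleCat.{0} A → Prop)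
    (hsub : IsSubcat χ) (hff : FunctoriallyFinite χ)
    (hext : ClosedUnderExtensions χ) (hproj : ContainsProjectives χ)
    (len : ModuleCat.{0} A → ℕ)
    (hlen : ∀ X : ModuleCat.{0} A, Module.Finite A X → IsJHLength X (len X))
    -- `Γ` is a connected component of the Auslander–Reiten quiver of `χ`
    (Γ : Set (ModuleCat.{0} A)) (hne : Γ.Nonempty)
    (hmem : ∀ X ∈ Γ, χ X ∧ Indec X)
    (hcomp : ∀ X ∈ Γ, ∀ Y : ModuleCat.{0} A, χ Y → Indec Y →
      (Y ∈ Γ ↔ ARConnected χ X Y))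
    -- the lengths of the modules in `Γ` are bounded
    (b : ℕ) (hb : ∀ X ∈ Γ, len X ≤ b) :
    ∀ Y : ModuleCat.{0} A, χ Y → Indec Y → ∃ X ∈ Γ, Nonempty (Y ≅ X) := by
  refine fun Y hY hYi => ⟨Y, ?_, ⟨Iso.refl Y⟩⟩
  have hΓ : IsBoundedARClosed χ Γ b :=
    { mem := fun X hX => (hmem X hX).1
      indec := fun X hX => (hmem X hX).2
      step := fun X hX Y h => (hcomp X hX Y h.2.1 h.2.2.2.1).mpr (.single h)
      length_le := fun X hX => by
        obtain ⟨s, hs₀, hs₁, hs⟩ := hlen X (hsub.1 X (hmem X hX).1)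
        rw [← Module.length_compositionSeries s hs₀ hs₁, hs]
        exact Nat.cast_le.mpr (hb X hX) }
  exact hΓ.mem_of_indec K hA hsub hff hproj hne hY hYi
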